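/- Let α > 1, γ ∈ (0,1], M ≥ 1, C_F > 0, and set Φ(x) = x₁⁴ + x₂² + M for x ∈ ℝ². Let F : ℝ² → ℝ be continuous with |F(y)| ≤ K₀(|y| + 1) for all y and |F(x) − F(y)| ≤ C_F |x − y|^γ (Φ(x) + Φ(y)) for all x, y ∈ ℝ². Then there exists a constant C > 0, depending only on α, γ, M and C_F (in particular independent of δ), such that for every δ > 0, every twice continuously differentiable u : ℝ² → ℝ satisfying |u(y)| ≤ C₀(|y| + 1/δ) for all y (for some C₀ > 0) and solving δ u(y) − (∂²u/∂y₁²(y) + y₁² ∂²u/∂y₂²(y)) + α y·∇u(y) = F(y) on ℝ², obeys |u(x) − u(y)| ≤ C |x − y|^γ (Φ(x) + Φ(y)) for all x, y ∈ ℝ². -/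

import Mathlib

/-- Euclidean norm on `ℝ²`. -/
noncomputable def nrm (p : ℝ × ℝ) : ℝ := Real.sqrt (p.1 ^ 2 + p.2 ^ 2)

/-- First partial derivative `∂u/∂y₁`. -/
noncomputable def pd1 (u : ℝ × ℝ → ℝ) (p : ℝ × ℝ) : ℝ := deriv (fun t => u (t, p.2)) p.1

/-- First partial derivative `∂u/∂y₂`. -/
noncomputable def pd2 (u : ℝ × ℝ → ℝ) (p : ℝ × ℝ) : ℝ := deriv (fun t => u (p.1, t)) p.2

/-- Second partial derivative `∂²u/∂y₁²`. -/
noncomputable def pd11 (u : ℝ × ℝ → ℝ) (p : ℝ × ℝ) : ℝ := deriv (fun t => pd1 u (t, p.2)) p.1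

/-- Second partial derivative `∂²u/∂y₂²`. -/
noncomputable def pd22 (u : ℝ × ℝ → ℝ) (p : ℝ × ℝ) : ℝ := deriv (fun t => pd2 u (p.1, t)) p.2

/-- The Grushin–Ornstein–Uhlenbeck operator
`u ↦ −(∂²u/∂y₁² + y₁² ∂²u/∂y₂²) + α y·∇u` on `ℝ²`. -/
noncomputable def GOU (α : ℝ) (u : ℝ × ℝ → ℝ) (p : ℝ × ℝ) : ℝ :=
  -(pd11 u p + p.1 ^ 2 * pd22 u p) + α * (p.1 * pd1 u p + p.2 * pd2 u p)

/-- The weight `Φ(x) = x₁⁴ + x₂² + M`. -/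
noncomputable def Phi (M : ℝ) (x : ℝ × ℝ) : ℝ := x.1 ^ 4 + x.2 ^ 2 + M

/-- Second derivative test against a quartic touching from above. -/
theorem second_deriv_le_of_le_quartic {f f' : ℝ → ℝ} {f'' a b c d : ℝ}
    (h1 : ∀ t, HasDerivAt f (f' t) t) (h2 : HasDerivAt f' f'' 0)
    (h : ∀ t, f t ≤ f 0 + (a * t + b * t ^ 2 + c * t ^ 3 + d * t ^ 4)) : f'' ≤ 2 * b := by
  set g : ℝ → ℝ := fun t => f t - (a * t + b * t ^ 2 + c * t ^ 3 + d * t ^ 4) with hg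
  set g' : ℝ → ℝ := fun t => f' t - (a + 2 * b * t + 3 * c * t ^ 2 + 4 * d * t ^ 3) with hg'
  have hd1 : ∀ t, HasDerivAt g (g' t) t := by
    intro t
    refine (h1 t).sub ?_
    have := ((((hasDerivAt_id t).const_mul a).add (((hasDerivAt_id t).pow 2).const_mul b)).add
      (((hasDerivAt_id t).pow 3).const_mul c)).add (((hasDerivAt_id t).pow 4).const_mul d)
    refine this.congr_deriv ?_
    simp
    ring
  have hd2 : HasDerivAt g' (f'' - 2 * b) 0 := by
    refine h2.sub ?_
    have := (((hasDerivAt_const (0 : ℝ) a).add ((hasDerivAt_id (0 : ℝ)).const_mul (2 * b))).add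
      (((hasDerivAt_id (0 : ℝ)).pow 2).const_mul (3 * c))).add
      (((hasDerivAt_id (0 : ℝ)).pow 3).const_mul (4 * d))
    refine this.congr_deriv ?_
    simp
  have hderiv : deriv g = g' := funext fun t => (hd1 t).deriv
  have hmax : IsLocalMax g 0 := Filter.Eventually.of_forall fun t => by
    have := h t
    simp only [hg]
    linarith
  by_contra! hlt
  have hpos : 0 < deriv (deriv g) 0 := by
    rw [hderiv, hd2.deriv]
    linarith
  have hmin : IsLocalMin g 0 :=
    isLocalMin_of_deriv_deriv_pos hpos hmax.deriv_eq_zero (hd1 0).continuousAt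
  have hconst : g =ᶠ[nhds 0] fun _ => g 0 := by
    filter_upwards [hmax, hmin] with t h₁ h₂
    exact le_antisymm h₁ h₂
  have : deriv (deriv g) 0 = 0 := by
    rw [hconst.deriv.deriv_eq]
    simp
  linarith

/-- First derivative test against a differentiable function touching from above. -/
theorem deriv_eq_of_le_touching {f q : ℝ → ℝ} {f' q' : ℝ} (hf : HasDerivAt f f' 0)
    (hq : HasDerivAt q q' 0) (h : ∀ t, f t ≤ f 0 + (q t - q 0)) : f' = q' := by
  have hmax : IsLocalMax (fun t => f t - q t) 0 := Filter.Eventually.of_forall fun t => by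
    have := h t
    simp only
    linarith
  have := hmax.hasDerivAt_eq_zero (hf.sub hq)
  linarith

theorem hasDerivAt_pd1 {u : ℝ × ℝ → ℝ} (hu : ContDiff ℝ 2 u) (a b : ℝ) :
    HasDerivAt (fun s => u (s, b)) (pd1 u (a, b)) a := by
  have h : ContDiff ℝ 2 (fun s => u (s, b)) := by fun_prop
  exact (h.differentiable (by norm_num) a).hasDerivAt

theorem hasDerivAt_pd2 {u : ℝ × ℝ → ℝ} (hu : ContDiff ℝ 2 u) (a b : ℝ) :
    HasDerivAt (fun s => u (a, s)) (pd2 u (a, b)) b := by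
  have h : ContDiff ℝ 2 (fun s => u (a, s)) := by fun_prop
  exact (h.differentiable (by norm_num) b).hasDerivAt

theorem hasDerivAt_pd11 {u : ℝ × ℝ → ℝ} (hu : ContDiff ℝ 2 u) (a b : ℝ) :
    HasDerivAt (fun s => pd1 u (s, b)) (pd11 u (a, b)) a := by
  have h : ContDiff ℝ (1 + 1) (fun s => u (s, b)) := by
    rw [one_add_one_eq_two]
    fun_prop
  have h' : Differentiable ℝ (deriv fun s => u (s, b)) :=
    (contDiff_succ_iff_deriv.1 h).2.2.differentiable (by norm_num)
  exact (h' a).hasDerivAt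

theorem hasDerivAt_pd22 {u : ℝ × ℝ → ℝ} (hu : ContDiff ℝ 2 u) (a b : ℝ) :
    HasDerivAt (fun s => pd2 u (a, s)) (pd22 u (a, b)) b := by
  have h : ContDiff ℝ (1 + 1) (fun s => u (a, s)) := by
    rw [one_add_one_eq_two]
    fun_prop
  have h' : Differentiable ℝ (deriv fun s => u (a, s)) :=
    (contDiff_succ_iff_deriv.1 h).2.2.differentiable (by norm_num)
  exact (h' b).hasDerivAt

theorem hasDerivAt_radial {u : ℝ × ℝ → ℝ} (hu : ContDiff ℝ 2 u) (a b : ℝ) :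
    HasDerivAt (fun t => u ((1 + t) * a, (1 + t) * b)) (a * pd1 u (a, b) + b * pd2 u (a, b)) 0 := by
  have hF : HasFDerivAt u (fderiv ℝ u (a, b)) (a, b) :=
    (hu.differentiable (by norm_num) (a, b)).hasFDerivAt
  have e1 : pd1 u (a, b) = fderiv ℝ u (a, b) (1, 0) :=
    (hasDerivAt_pd1 hu a b).unique
      (hF.comp_hasDerivAt a ((hasDerivAt_id a).prodMk (hasDerivAt_const a b)))
  have e2 : pd2 u (a, b) = fderiv ℝ u (a, b) (0, 1) :=
    (hasDerivAt_pd2 hu a b).unique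
      (hF.comp_hasDerivAt b ((hasDerivAt_const b a).prodMk (hasDerivAt_id b)))
  have hc : HasDerivAt (fun t : ℝ => ((1 + t) * a, (1 + t) * b)) (a, b) 0 := by
    have h1 : HasDerivAt (fun t : ℝ => 1 + t) 1 0 := (hasDerivAt_id (0 : ℝ)).const_add 1
    have := (h1.mul_const a).prodMk (h1.mul_const b)
    simpa using this
  have hF' : HasFDerivAt u (fderiv ℝ u (a, b)) ((1 + (0 : ℝ)) * a, (1 + (0 : ℝ)) * b) := by
    simpa using hF
  refine (hF'.comp_hasDerivAt (0 : ℝ) hc).congr_deriv ?_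
  have : ((a, b) : ℝ × ℝ) = a • ((1, 0) : ℝ × ℝ) + b • ((0, 1) : ℝ × ℝ) := by simp
  rw [e1, e2]
  conv_lhs => arg 2; rw [this]
  rw [map_add, map_smul, map_smul]
  simp

theorem nrm_nonneg (p : ℝ × ℝ) : 0 ≤ nrm p := Real.sqrt_nonneg _

theorem nrm_sq (p : ℝ × ℝ) : nrm p ^ 2 = p.1 ^ 2 + p.2 ^ 2 := Real.sq_sqrt (by positivity)

theorem continuous_nrm : Continuous nrm := by
  unfold nrm
  fun_prop

theorem continuous_Phi (M : ℝ) : Continuous (Phi M) := by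
  unfold Phi
  fun_prop

theorem Phi_pos {M : ℝ} (hM : 1 ≤ M) (x : ℝ × ℝ) : 0 < Phi M x := by
  unfold Phi
  positivity

/-- Tangent-line bound for the concave power `s ↦ s ^ (γ / 2)` of the squared distance. -/
theorem nrm_rpow_le_tangent {γ : ℝ} (hγ0 : 0 < γ) (hγ1 : γ ≤ 1) {z : ℝ × ℝ} (hz : 0 < nrm z)
    (w : ℝ × ℝ) :
    nrm w ^ γ ≤ nrm z ^ γ * (1 + γ / 2 * (nrm w ^ 2 / nrm z ^ 2 - 1)) := by
  have hratio : nrm w ^ γ = nrm z ^ γ * (nrm w ^ 2 / nrm z ^ 2) ^ (γ / 2) := by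
    rw [← div_pow, ← Real.rpow_natCast, ← Real.rpow_mul (div_nonneg (nrm_nonneg w) hz.le),
      show ((2 : ℕ) : ℝ) * (γ / 2) = γ by push_cast; ring,
      Real.div_rpow (nrm_nonneg w) hz.le]
    have := (Real.rpow_pos_of_pos hz γ).ne'
    field_simp
  rw [hratio]
  gcongr
  have h := rpow_one_add_le_one_add_mul_self
    (s := nrm w ^ 2 / nrm z ^ 2 - 1) (p := γ / 2)
    (by have : 0 ≤ nrm w ^ 2 / nrm z ^ 2 := by positivity
        linarith) (by linarith) (by linarith)
  simpa using h

/-- The doubled-variables functional with barrier `K |x-y|^γ (Φ(x)+Φ(y))` and penalization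
`ε (Φ(x)+Φ(y)+A)`. -/
noncomputable def doubled (γ N K ε A : ℝ) (u : ℝ × ℝ → ℝ) (q : (ℝ × ℝ) × (ℝ × ℝ)) : ℝ :=
  u q.1 - u q.2 - K * nrm (q.1 - q.2) ^ γ * (Phi N q.1 + Phi N q.2)
    - ε * (Phi N q.1 + Phi N q.2 + A)

/-- A quartic-quadratic quantity with linear growth has bounded argument. -/
theorem sq_add_sq_le_of_growth {C ε L N x₁ x₂ n : ℝ} (hε : 0 < ε) (hn : n ^ 2 = x₁ ^ 2 + x₂ ^ 2)
    (h : ε * (x₁ ^ 4 + x₂ ^ 2 + N) ≤ C * n + L) :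
    x₁ ^ 2 + x₂ ^ 2 ≤ 2 / ε * (L + C ^ 2 / (2 * ε) + ε * (1 - N)) := by
  have h1 : C * n ≤ ε / 2 * n ^ 2 + C ^ 2 / (2 * ε) := by
    have : ε / 2 * n ^ 2 + C ^ 2 / (2 * ε) - C * n = (ε * n - C) ^ 2 / (2 * ε) := by
      field_simp
      ring
    have : 0 ≤ (ε * n - C) ^ 2 / (2 * ε) := by positivity
    linarith
  have h2 : x₁ ^ 2 ≤ x₁ ^ 4 + 1 := by nlinarith [sq_nonneg (x₁ ^ 2 - 1)]
  have h3 : ε * x₁ ^ 2 ≤ ε * (x₁ ^ 4 + 1) := by gcongr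
  rw [div_mul_eq_mul_div, le_div_iff₀ hε]
  rw [hn] at h1
  nlinarith

/-- A positive value of the doubled functional forces a global maximum with positive value. -/
theorem exists_max_doubled {γ N K ε A C₀ δ : ℝ} (hγ : 0 < γ) (hN : 1 ≤ N) (hK : 0 < K)
    (hε : 0 < ε) (hA : 0 < A) (hC₀ : 0 < C₀) {u : ℝ × ℝ → ℝ} (hu : Continuous u)
    (hgrowth : ∀ y, |u y| ≤ C₀ * (nrm y + 1 / δ)) {q₀ : (ℝ × ℝ) × (ℝ × ℝ)}
    (hq₀ : 0 < doubled γ N K ε A u q₀) :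
    ∃ q, 0 < doubled γ N K ε A u q ∧
      ∀ q', doubled γ N K ε A u q' ≤ doubled γ N K ε A u q := by
  have hcont : Continuous (doubled γ N K ε A u) := by
    unfold doubled
    have h1 := continuous_Phi N
    have h2 := continuous_nrm
    have h3 : Continuous fun q : (ℝ × ℝ) × (ℝ × ℝ) => nrm (q.1 - q.2) ^ γ :=
      (h2.comp (by fun_prop)).rpow_const fun _ => Or.inr hγ.le
    fun_prop
  obtain ⟨B, hB⟩ : ∃ B : ℝ, ∀ x y : ℝ × ℝ, 0 ≤ doubled γ N K ε A u (x, y) →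
      x.1 ^ 2 + x.2 ^ 2 ≤ B ∧ y.1 ^ 2 + y.2 ^ 2 ≤ B := by
    refine ⟨2 / ε * ((C₀ * (1 / δ) * 2 + C₀ ^ 2 / ε + ε) + C₀ ^ 2 / (2 * ε) + ε * (1 - N)), ?_⟩
    intro x y h
    have hbar : 0 ≤ K * nrm (x - y) ^ γ * (Phi N x + Phi N y) :=
      mul_nonneg (mul_nonneg hK.le (Real.rpow_nonneg (nrm_nonneg _) _))
        (add_pos (Phi_pos hN x) (Phi_pos hN y)).le
    have hx := (abs_le.1 (hgrowth x)).2
    have hy := (abs_le.1 (hgrowth y)).1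
    have hεA : 0 < ε * A := by positivity
    have hlow : ∀ p : ℝ × ℝ, C₀ * nrm p ≤ ε * Phi N p + (C₀ ^ 2 / ε + ε) := by
      intro p
      have h1 : C₀ * nrm p ≤ ε * nrm p ^ 2 + C₀ ^ 2 / ε := by
        have e : ε * nrm p ^ 2 + C₀ ^ 2 / ε - C₀ * nrm p
            = ((ε * nrm p - C₀) ^ 2 + ε * C₀ * nrm p) / ε := by
          field_simp
          ring
        have := nrm_nonneg p
        have : 0 ≤ ((ε * nrm p - C₀) ^ 2 + ε * C₀ * nrm p) / ε := by positivity
        linarith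
      have h2 : nrm p ^ 2 ≤ Phi N p + 1 := by
        rw [nrm_sq]
        unfold Phi
        nlinarith [sq_nonneg (p.1 ^ 2 - 1)]
      nlinarith
    have hlx := hlow x
    have hly := hlow y
    simp only [doubled] at h
    constructor
    · refine sq_add_sq_le_of_growth hε (nrm_sq x) (C := C₀) ?_
      change ε * Phi N x ≤ _
      linarith
    · refine sq_add_sq_le_of_growth hε (nrm_sq y) (C := C₀) ?_
      change ε * Phi N y ≤ _
      linarith
  have hclosed : IsClosed {q | 0 ≤ doubled γ N K ε A u q} := isClosed_le continuous_const hcont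
  have hcomp : IsCompact {q | 0 ≤ doubled γ N K ε A u q} := by
    refine (isCompact_closedBall (0 : (ℝ × ℝ) × (ℝ × ℝ)) (Real.sqrt B)).of_isClosed_subset
      hclosed ?_
    rintro ⟨x, y⟩ hq
    obtain ⟨hx, hy⟩ := hB x y hq
    rw [mem_closedBall_zero_iff]
    simp only [Prod.norm_def, Real.norm_eq_abs, max_le_iff]
    refine ⟨⟨?_, ?_⟩, ?_, ?_⟩ <;> apply Real.abs_le_sqrt <;> nlinarith [sq_nonneg x.1,
      sq_nonneg x.2, sq_nonneg y.1, sq_nonneg y.2]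
  obtain ⟨q, hq, hmax⟩ := hcomp.exists_isMaxOn ⟨q₀, hq₀.le⟩ hcont.continuousOn
  have hqpos : 0 < doubled γ N K ε A u q := hq₀.trans_le (hmax hq₀.le)
  refine ⟨q, hqpos, fun q' => ?_⟩
  by_cases h : 0 ≤ doubled γ N K ε A u q'
  · exact hmax h
  · linarith

/-- First and second order conditions at a maximum of the doubled functional off the diagonal. -/
theorem doubled_max_conditions {γ N K ε A : ℝ} (hγ0 : 0 < γ) (hγ1 : γ ≤ 1) (hN : 1 ≤ N)
    (hK : 0 < K) {u : ℝ × ℝ → ℝ} (hu : ContDiff ℝ 2 u) {x₁ x₂ y₁ y₂ G R S : ℝ}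
    (hz : 0 < nrm ((x₁, x₂) - (y₁, y₂)))
    (hmax : ∀ q, doubled γ N K ε A u q ≤ doubled γ N K ε A u ((x₁, x₂), (y₁, y₂)))
    (hG : G = nrm ((x₁, x₂) - (y₁, y₂)) ^ γ) (hR : R = (x₁ - y₁) ^ 2 + (x₂ - y₂) ^ 2)
    (hS : S = Phi N (x₁, x₂) + Phi N (y₁, y₂)) :
    pd11 u (x₁, x₂) - pd11 u (y₁, y₂) ≤ (K * G + ε) * (12 * (x₁ ^ 2 + y₁ ^ 2)) ∧
    x₁ ^ 2 * pd22 u (x₁, x₂) - y₁ ^ 2 * pd22 u (y₁, y₂) ≤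
      K * G * (2 * (x₁ ^ 2 + y₁ ^ 2)
        + 4 * γ * ((x₁ - y₁) * (x₂ - y₂) / R) * (x₁ * x₂ + y₁ * y₂)
        + γ * ((x₁ - y₁) ^ 2 / R) * S) + 2 * ε * (x₁ ^ 2 + y₁ ^ 2) ∧
    (x₁ * pd1 u (x₁, x₂) + x₂ * pd2 u (x₁, x₂)) - (y₁ * pd1 u (y₁, y₂) + y₂ * pd2 u (y₁, y₂)) =
      K * G * (γ * S + (4 * (x₁ ^ 4 + y₁ ^ 4) + 2 * (x₂ ^ 2 + y₂ ^ 2)))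
        + ε * (4 * (x₁ ^ 4 + y₁ ^ 4) + 2 * (x₂ ^ 2 + y₂ ^ 2)) := by
  have hzsq : nrm ((x₁, x₂) - (y₁, y₂)) ^ 2 = R := by
    rw [nrm_sq, hR]
    rfl
  have hRpos : 0 < R := by
    rw [← hzsq]
    positivity
  have key : ∀ a₁ a₂ b₁ b₂ : ℝ, u (a₁, a₂) - u (b₁, b₂) ≤ u (x₁, x₂) - u (y₁, y₂)
      + (K * (G * (1 + γ / 2 * (((a₁ - b₁) ^ 2 + (a₂ - b₂) ^ 2) / R - 1)))
          * (a₁ ^ 4 + a₂ ^ 2 + N + (b₁ ^ 4 + b₂ ^ 2 + N)) - K * G * S)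
      + ε * (a₁ ^ 4 + a₂ ^ 2 + N + (b₁ ^ 4 + b₂ ^ 2 + N) - S) := by
    intro a₁ a₂ b₁ b₂
    have h := hmax ((a₁, a₂), (b₁, b₂))
    have ht := nrm_rpow_le_tangent hγ0 hγ1 hz ((a₁, a₂) - (b₁, b₂))
    rw [hzsq, ← hG, nrm_sq] at ht
    have hP : 0 < Phi N (a₁, a₂) + Phi N (b₁, b₂) := add_pos (Phi_pos hN _) (Phi_pos hN _)
    have ht' := mul_le_mul_of_nonneg_right (mul_le_mul_of_nonneg_left ht hK.le) hP.le
    simp only [doubled] at h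
    rw [← hG, ← hS] at h
    simp only [Phi, Prod.fst_sub, Prod.snd_sub] at h ht'
    linarith
  have hS' : S = x₁ ^ 4 + x₂ ^ 2 + N + (y₁ ^ 4 + y₂ ^ 2 + N) := hS
  refine ⟨?_, ?_, ?_⟩
  · have hd1 : ∀ t : ℝ, HasDerivAt (fun t => u (x₁ + t, x₂) - u (y₁ + t, y₂))
        (pd1 u (x₁ + t, x₂) - pd1 u (y₁ + t, y₂)) t := fun t =>
      ((hasDerivAt_pd1 hu (x₁ + t) x₂).comp_const_add x₁ t).sub
        ((hasDerivAt_pd1 hu (y₁ + t) y₂).comp_const_add y₁ t)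
    have hd2 : HasDerivAt (fun t => pd1 u (x₁ + t, x₂) - pd1 u (y₁ + t, y₂))
        (pd11 u (x₁, x₂) - pd11 u (y₁, y₂)) 0 := by
      refine (((hasDerivAt_pd11 hu (x₁ + 0) x₂).comp_const_add x₁ 0).sub
        ((hasDerivAt_pd11 hu (y₁ + 0) y₂).comp_const_add y₁ 0)).congr_deriv ?_
      simp only [add_zero]
    refine (second_deriv_le_of_le_quartic hd1 hd2
      (a := (K * G + ε) * (4 * (x₁ ^ 3 + y₁ ^ 3))) (b := (K * G + ε) * (6 * (x₁ ^ 2 + y₁ ^ 2)))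
      (c := (K * G + ε) * (4 * (x₁ + y₁))) (d := (K * G + ε) * 2) fun t => ?_).trans_eq (by ring)
    have h := key (x₁ + t) x₂ (y₁ + t) y₂
    have e : ((x₁ + t - (y₁ + t)) ^ 2 + (x₂ - y₂) ^ 2) / R = 1 := by
      rw [add_sub_add_right_eq_sub, ← hR, div_self hRpos.ne']
    rw [e, hS'] at h
    simp only [add_zero]
    linarith
  · have aff : ∀ b m t : ℝ, HasDerivAt (fun t => b + t * m) m t := fun b m t => by
      simpa using ((hasDerivAt_id t).mul_const m).const_add b
    have hd1 : ∀ t : ℝ, HasDerivAt (fun t => u (x₁, x₂ + t * x₁) - u (y₁, y₂ + t * y₁))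
        (pd2 u (x₁, x₂ + t * x₁) * x₁ - pd2 u (y₁, y₂ + t * y₁) * y₁) t := fun t => by
      have hx := HasDerivAt.comp t (hasDerivAt_pd2 hu x₁ (x₂ + t * x₁)) (aff x₂ x₁ t)
      have hy := HasDerivAt.comp t (hasDerivAt_pd2 hu y₁ (y₂ + t * y₁)) (aff y₂ y₁ t)
      exact hx.sub hy
    have hd2 : HasDerivAt (fun t => pd2 u (x₁, x₂ + t * x₁) * x₁ - pd2 u (y₁, y₂ + t * y₁) * y₁)
        (x₁ ^ 2 * pd22 u (x₁, x₂) - y₁ ^ 2 * pd22 u (y₁, y₂)) 0 := by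
      refine (((HasDerivAt.comp (0 : ℝ) (hasDerivAt_pd22 hu x₁ (x₂ + 0 * x₁))
        (aff x₂ x₁ 0)).mul_const x₁).sub ((HasDerivAt.comp (0 : ℝ)
        (hasDerivAt_pd22 hu y₁ (y₂ + 0 * y₁)) (aff y₂ y₁ 0)).mul_const y₁)).congr_deriv ?_
      simp only [zero_mul, add_zero]
      ring
    set m := (x₁ - y₁) * (x₂ - y₂) / R with hm
    set n := (x₁ - y₁) ^ 2 / R with hn
    set B := x₁ * x₂ + y₁ * y₂ with hB
    set D := x₁ ^ 2 + y₁ ^ 2 with hD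
    refine (second_deriv_le_of_le_quartic hd1 hd2
      (a := K * G * (2 * B + γ * m * S) + 2 * ε * B)
      (b := K * G * (D + 2 * γ * m * B + γ / 2 * n * S) + ε * D)
      (c := K * G * (γ * m * D + γ * n * B)) (d := K * G * (γ / 2 * n * D))
      fun t => ?_).trans_eq (by ring)
    have h := key x₁ (x₂ + t * x₁) y₁ (y₂ + t * y₁)
    have e : ((x₁ - y₁) ^ 2 + (x₂ + t * x₁ - (y₂ + t * y₁)) ^ 2) / R - 1
        = 2 * t * m + t ^ 2 * n := by
      rw [hm, hn]
      field_simp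
      rw [hR]
      ring
    have e' : x₁ ^ 4 + (x₂ + t * x₁) ^ 2 + N + (y₁ ^ 4 + (y₂ + t * y₁) ^ 2 + N)
        = S + 2 * t * B + t ^ 2 * D := by
      rw [hS', hB, hD]
      ring
    rw [e, e'] at h
    simp only [zero_mul, add_zero]
    linarith
  · refine deriv_eq_of_le_touching
      (q := fun t : ℝ => K * G * ((1 + γ / 2 * ((1 + t) ^ 2 - 1))
          * ((1 + t) ^ 4 * (x₁ ^ 4 + y₁ ^ 4) + (1 + t) ^ 2 * (x₂ ^ 2 + y₂ ^ 2) + 2 * N))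
        + ε * ((1 + t) ^ 4 * (x₁ ^ 4 + y₁ ^ 4) + (1 + t) ^ 2 * (x₂ ^ 2 + y₂ ^ 2) + 2 * N))
      ((hasDerivAt_radial hu x₁ x₂).sub (hasDerivAt_radial hu y₁ y₂)) ?_ fun t => ?_
    · have h1 : HasDerivAt (fun t : ℝ => 1 + t) 1 0 := (hasDerivAt_id (0 : ℝ)).const_add 1
      have hP := (((h1.pow 4).mul_const (x₁ ^ 4 + y₁ ^ 4)).add
        ((h1.pow 2).mul_const (x₂ ^ 2 + y₂ ^ 2))).add_const (2 * N)
      have hc := (((h1.pow 2).sub_const 1).const_mul (γ / 2)).const_add 1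
      refine (((hc.mul hP).const_mul (K * G)).add (hP.const_mul ε)).congr_deriv ?_
      rw [hS']
      simp only [Pi.pow_apply, Pi.add_apply, Nat.cast_ofNat, Nat.reduceSub]
      ring
    · have h := key ((1 + t) * x₁) ((1 + t) * x₂) ((1 + t) * y₁) ((1 + t) * y₂)
      have e : (((1 + t) * x₁ - (1 + t) * y₁) ^ 2 + ((1 + t) * x₂ - (1 + t) * y₂) ^ 2) / R
          = (1 + t) ^ 2 := by
        rw [hR] at hRpos ⊢
        field_simp
      rw [e, hS'] at h
      simp only [Pi.sub_apply, add_zero, one_mul]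
      linarith

/-- Strict supersolution property of the barrier: the coefficient it leaves in the doubled equation
dominates a multiple of `S = Φ(x) + Φ(y)`. -/
theorem barrier_coefficient_lower_bound {α γ N R S x₁ x₂ y₁ y₂ : ℝ} (hα : 1 < α)
    (hγ0 : 0 < γ) (hγ1 : γ ≤ 1) (hN : 29 ≤ (α - 1) * γ * N) (hRpos : 0 < R)
    (hR : R = (x₁ - y₁) ^ 2 + (x₂ - y₂) ^ 2)
    (hS : S = x₁ ^ 4 + x₂ ^ 2 + N + (y₁ ^ 4 + y₂ ^ 2 + N)) (hSpos : 0 < S) :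
    (α - 1) * γ / 2 * S ≤
      α * (γ * S + (4 * (x₁ ^ 4 + y₁ ^ 4) + 2 * (x₂ ^ 2 + y₂ ^ 2))) - 14 * (x₁ ^ 2 + y₁ ^ 2)
        - 4 * γ * ((x₁ - y₁) * (x₂ - y₂) / R) * (x₁ * x₂ + y₁ * y₂)
        - γ * ((x₁ - y₁) ^ 2 / R) * S := by
  set m := (x₁ - y₁) * (x₂ - y₂) / R with hm
  set n := (x₁ - y₁) ^ 2 / R with hn
  have hn1 : n ≤ 1 := by
    rw [hn, div_le_one hRpos, hR]
    nlinarith [sq_nonneg (x₂ - y₂)]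
  have hm1 : |m| ≤ 1 / 2 := by
    rw [hm, abs_div, abs_of_pos hRpos, div_le_iff₀ hRpos, hR, abs_le]
    constructor <;> nlinarith [sq_nonneg (x₁ - y₁ + (x₂ - y₂)), sq_nonneg (x₁ - y₁ - (x₂ - y₂))]
  have hB : |x₁ * x₂ + y₁ * y₂| ≤ (x₁ ^ 2 + y₁ ^ 2 + x₂ ^ 2 + y₂ ^ 2) / 2 := by
    rw [abs_le]
    constructor <;> nlinarith [sq_nonneg (x₁ + x₂), sq_nonneg (x₁ - x₂), sq_nonneg (y₁ + y₂),
      sq_nonneg (y₁ - y₂)]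
  have hcross : 4 * γ * m * (x₁ * x₂ + y₁ * y₂) ≤ x₁ ^ 2 + y₁ ^ 2 + x₂ ^ 2 + y₂ ^ 2 := by
    have h1 : m * (x₁ * x₂ + y₁ * y₂) ≤ 1 / 2 * ((x₁ ^ 2 + y₁ ^ 2 + x₂ ^ 2 + y₂ ^ 2) / 2) :=
      (le_abs_self _).trans (by
        rw [abs_mul]
        exact mul_le_mul hm1 hB (abs_nonneg _) (by norm_num))
    have h2 : γ * (m * (x₁ * x₂ + y₁ * y₂))
        ≤ γ * (1 / 2 * ((x₁ ^ 2 + y₁ ^ 2 + x₂ ^ 2 + y₂ ^ 2) / 2)) :=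
      mul_le_mul_of_nonneg_left h1 hγ0.le
    have h3 : γ * (1 / 2 * ((x₁ ^ 2 + y₁ ^ 2 + x₂ ^ 2 + y₂ ^ 2) / 2))
        ≤ 1 * (1 / 2 * ((x₁ ^ 2 + y₁ ^ 2 + x₂ ^ 2 + y₂ ^ 2) / 2)) :=
      mul_le_mul_of_nonneg_right hγ1 (by positivity)
    linarith
  have hnS : γ * n * S ≤ γ * S := by
    have : γ * S * n ≤ γ * S * 1 := by gcongr
    linarith
  set E := 4 * (x₁ ^ 4 + y₁ ^ 4) + 2 * (x₂ ^ 2 + y₂ ^ 2) with hE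
  have hαE : E ≤ α * E := le_mul_of_one_le_left (by positivity) hα.le
  have hκS : 29 ≤ (α - 1) * γ / 2 * S := by
    have h1 : (α - 1) * γ * (2 * N) ≤ (α - 1) * γ * S := by
      have : 0 < (α - 1) * γ := mul_pos (by linarith) hγ0
      gcongr
      rw [hS]
      nlinarith [sq_nonneg (x₁ ^ 2), sq_nonneg (y₁ ^ 2), sq_nonneg x₂, sq_nonneg y₂]
    linarith
  have hx : 15 * x₁ ^ 2 ≤ 4 * x₁ ^ 4 + 29 / 2 := by nlinarith [sq_nonneg (x₁ ^ 2 - 15 / 8)]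
  have hy : 15 * y₁ ^ 2 ≤ 4 * y₁ ^ 4 + 29 / 2 := by nlinarith [sq_nonneg (y₁ ^ 2 - 15 / 8)]
  have := sq_nonneg x₂
  have := sq_nonneg y₂
  nlinarith

/-- For admissible parameters the doubled functional is nonpositive. -/
theorem doubled_nonpos {α γ N K ε δ C_F C₀ : ℝ} (hα : 1 < α) (hγ0 : 0 < γ) (hγ1 : γ ≤ 1)
    (hN1 : 1 ≤ N) (hN : 29 ≤ (α - 1) * γ * N) (hK : 0 < K) (hKF : C_F ≤ K * ((α - 1) * γ / 2))
    (hε : 0 < ε) (hδ : 0 < δ) (hC₀ : 0 < C₀) {F u : ℝ × ℝ → ℝ}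
    (hF : ∀ x y : ℝ × ℝ, |F x - F y| ≤ C_F * nrm (x - y) ^ γ * (Phi N x + Phi N y))
    (hu : ContDiff ℝ 2 u) (hgrowth : ∀ y, |u y| ≤ C₀ * (nrm y + 1 / δ))
    (heq : ∀ y, δ * u y + GOU α u y = F y) (q : (ℝ × ℝ) × (ℝ × ℝ)) :
    doubled γ N K ε (25 / δ) u q ≤ 0 := by
  by_contra! hq
  have hA : 0 < 25 / δ := by positivity
  obtain ⟨⟨⟨x₁, x₂⟩, ⟨y₁, y₂⟩⟩, hpos, hmax⟩ :=
    exists_max_doubled hγ0 hN1 hK hε hA hC₀ hu.continuous hgrowth hq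
  have hSpos : 0 < Phi N (x₁, x₂) + Phi N (y₁, y₂) := add_pos (Phi_pos hN1 _) (Phi_pos hN1 _)
  have hz : 0 < nrm ((x₁, x₂) - (y₁, y₂)) := by
    refine (nrm_nonneg _).lt_of_ne fun h => ?_
    have hsq := nrm_sq ((x₁, x₂) - (y₁, y₂))
    rw [← h] at hsq
    simp only [Prod.fst_sub, Prod.snd_sub] at hsq
    have h1 : x₁ = y₁ := by nlinarith [sq_nonneg (x₁ - y₁), sq_nonneg (x₂ - y₂)]
    have h2 : x₂ = y₂ := by nlinarith [sq_nonneg (x₁ - y₁), sq_nonneg (x₂ - y₂)]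
    simp only [doubled] at hpos
    rw [← h, Real.zero_rpow hγ0.ne', h1, h2] at hpos
    rw [h1, h2] at hSpos
    have : 0 < ε * (Phi N (y₁, y₂) + Phi N (y₁, y₂) + 25 / δ) := by positivity
    linarith
  obtain ⟨h11, h22, h1⟩ := doubled_max_conditions hγ0 hγ1 hN1 hK hu hz hmax rfl rfl rfl
  have hR : 0 < (x₁ - y₁) ^ 2 + (x₂ - y₂) ^ 2 := by
    have hsq := nrm_sq ((x₁, x₂) - (y₁, y₂))
    simp only [Prod.fst_sub, Prod.snd_sub] at hsq
    rw [← hsq]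
    positivity
  have hcoef := barrier_coefficient_lower_bound (x₁ := x₁) (x₂ := x₂) (y₁ := y₁) (y₂ := y₂)
    (S := Phi N (x₁, x₂) + Phi N (y₁, y₂)) hα hγ0 hγ1 hN hR rfl rfl hSpos
  have hFxy := (abs_le.1 (hF (x₁, x₂) (y₁, y₂))).2
  have hx := heq (x₁, x₂)
  have hy := heq (y₁, y₂)
  simp only [GOU] at hx hy
  simp only [doubled] at hpos
  set S := Phi N (x₁, x₂) + Phi N (y₁, y₂) with hS
  have hG : 0 < nrm ((x₁, x₂) - (y₁, y₂)) ^ γ := Real.rpow_pos_of_pos hz γ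
  set G := nrm ((x₁, x₂) - (y₁, y₂)) ^ γ
  set E := 4 * (x₁ ^ 4 + y₁ ^ 4) + 2 * (x₂ ^ 2 + y₂ ^ 2) with hE
  set D := x₁ ^ 2 + y₁ ^ 2 with hD
  have hδw : δ * (K * G * S + ε * (S + 25 / δ)) < δ * (u (x₁, x₂) - u (y₁, y₂)) := by
    gcongr
    linarith
  have hδA : δ * (K * G * S + ε * (S + 25 / δ)) = δ * (K * G * S + ε * S) + 25 * ε := by
    rw [mul_add, mul_add, mul_left_comm δ ε, mul_add δ S, mul_div_cancel₀ _ hδ.ne']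
    ring
  have hpart : 0 < δ * (K * G * S + ε * S) := by positivity
  have hpen : 0 ≤ ε * (25 + α * E - 14 * D) := by
    refine mul_nonneg hε.le ?_
    have hαE : E ≤ α * E := le_mul_of_one_le_left (by positivity) hα.le
    have hx₁ : 14 * x₁ ^ 2 ≤ 4 * x₁ ^ 4 + 49 / 4 := by linarith [sq_nonneg (2 * x₁ ^ 2 - 7 / 2)]
    have hy₁ : 14 * y₁ ^ 2 ≤ 4 * y₁ ^ 4 + 49 / 4 := by linarith [sq_nonneg (2 * y₁ ^ 2 - 7 / 2)]
    linarith only [hx₁, hy₁, hαE, hE, hD, sq_nonneg x₂, sq_nonneg y₂]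
  have hbar := mul_le_mul_of_nonneg_left hcoef (mul_pos hK hG).le
  have hCF : C_F * (G * S) ≤ K * ((α - 1) * γ / 2) * (G * S) := by gcongr
  have hα1 := congrArg (fun s => α * s) h1
  linarith only [hx, hy, h11, h22, hα1, hδw, hδA, hpart, hpen, hbar, hCF, hFxy]

/-- Local Hölder continuity of the approximated corrector: if `α > 1`,
`γ ∈ (0,1]`, `M ≥ 1` and `F` satisfies `|F(x) − F(y)| ≤ C_F|x−y|^γ(Φ(x)+Φ(y))`,
then any solution of `δu − Δ_G u + αy·∇u = F` with growth `C₀(|y|+1/δ)`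
satisfies `|u(x) − u(y)| ≤ C|x−y|^γ(Φ(x)+Φ(y))` with `C` depending only on
`α, γ, M, C_F` (in particular independent of `δ`). -/
theorem approx_corrector_holder (α γ M C_F : ℝ) (hα : 1 < α)
    (hγ0 : 0 < γ) (hγ1 : γ ≤ 1) (hM : 1 ≤ M) (hCF : 0 < C_F) :
    ∃ C > (0 : ℝ), ∀ K₀ > (0 : ℝ), ∀ F : ℝ × ℝ → ℝ, Continuous F →
      (∀ y : ℝ × ℝ, |F y| ≤ K₀ * (nrm y + 1)) →
      (∀ x y : ℝ × ℝ, |F x - F y| ≤ C_F * nrm (x - y) ^ γ * (Phi M x + Phi M y)) →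
      ∀ δ > (0 : ℝ), ∀ C₀ > (0 : ℝ), ∀ u : ℝ × ℝ → ℝ, ContDiff ℝ 2 u →
        (∀ y : ℝ × ℝ, |u y| ≤ C₀ * (nrm y + 1 / δ)) →
        (∀ y : ℝ × ℝ, δ * u y + GOU α u y = F y) →
        ∀ x y : ℝ × ℝ, |u x - u y| ≤ C * nrm (x - y) ^ γ * (Phi M x + Phi M y) := by
  have hκ : 0 < (α - 1) * γ := mul_pos (by linarith) hγ0
  set N : ℝ := M + 29 / ((α - 1) * γ) with hNdef
  have hquot : 0 < 29 / ((α - 1) * γ) := by positivity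
  have hMN : M ≤ N := by linarith
  have hN1 : 1 ≤ N := hM.trans hMN
  have hN : 29 ≤ (α - 1) * γ * N := by
    have h1 : (α - 1) * γ * (29 / ((α - 1) * γ)) = 29 := mul_div_cancel₀ _ hκ.ne'
    have h2 : 0 < (α - 1) * γ * M := by positivity
    rw [hNdef, mul_add]
    linarith
  set K : ℝ := 2 * C_F / ((α - 1) * γ) with hKdef
  have hK : 0 < K := by positivity
  have hKF : C_F ≤ K * ((α - 1) * γ / 2) := by
    have : K * ((α - 1) * γ / 2) = C_F := by
      rw [hKdef, ← mul_div_assoc, div_mul_cancel₀ _ hκ.ne', mul_div_cancel_left₀ _ two_ne_zero]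
    exact this.ge
  refine ⟨K * N, by positivity, ?_⟩
  intro K₀ _ F _ _ hF δ hδ C₀ hC₀ u hu hgrowth heq
  have hF' : ∀ x y : ℝ × ℝ, |F x - F y| ≤ C_F * nrm (x - y) ^ γ * (Phi N x + Phi N y) := by
    intro x y
    refine (hF x y).trans (mul_le_mul_of_nonneg_left ?_
      (mul_nonneg hCF.le (Real.rpow_nonneg (nrm_nonneg _) _)))
    unfold Phi
    linarith
  have hPhi : ∀ x, Phi N x ≤ N * Phi M x := by
    intro x
    have h1 : 0 ≤ x.1 ^ 4 + x.2 ^ 2 := by positivity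
    unfold Phi
    nlinarith
  have hone : ∀ x y : ℝ × ℝ, u x - u y ≤ K * N * nrm (x - y) ^ γ * (Phi M x + Phi M y) := by
    intro x y
    have hG : 0 ≤ nrm (x - y) ^ γ := Real.rpow_nonneg (nrm_nonneg _) _
    have hT : 0 < Phi N x + Phi N y + 25 / δ :=
      add_pos (add_pos (Phi_pos hN1 x) (Phi_pos hN1 y)) (by positivity)
    have hlim : u x - u y ≤ K * nrm (x - y) ^ γ * (Phi N x + Phi N y) := by
      refine le_of_forall_pos_le_add fun η hη => ?_
      have h := doubled_nonpos hα hγ0 hγ1 hN1 hN hK hKF (div_pos hη hT) hδ hC₀ hF' hu hgrowth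
        heq (x, y)
      simp only [doubled] at h
      rw [div_mul_cancel₀ _ hT.ne'] at h
      linarith
    have h := mul_le_mul_of_nonneg_left (add_le_add (hPhi x) (hPhi y)) (mul_nonneg hK.le hG)
    linarith
  intro x y
  rw [abs_le]
  refine ⟨?_, hone x y⟩
  have h := hone y x
  have hsymm : nrm (y - x) = nrm (x - y) := by
    simp only [nrm, Prod.fst_sub, Prod.snd_sub]
    congr 1
    ring
  rw [hsymm, add_comm (Phi M y)] at h
  linarith
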